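/- Let G be a finite graph, let M be a module of G, and let x ∈ M. Then the twin-width of G equals the maximum of the twin-width of the subgraph of G induced by M and the twin-width of the subgraph of G induced by (V(G) ∖ M) ∪ {x}. -/

import Mathlib

/-!
Twin-width, formalized via contraction sequences.

A sequence of `d`-contractions for a graph `G` is modeled by the sequence of
partitions of the vertex set of `G` whose parts are the sets of original
vertices merged (by the successive contractions) into a single vertex of the
current trigraph.  Under this correspondence, two distinct parts are joined by
a red edge precisely when they are "mixed" in `G` (neither completely adjacent
nor completely nonadjacent), and by a black edge when completely adjacent.
-/

/-- Parts `P` and `Q` form a red (mixed) pair with respect to `G`: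
neither complete nor anticomplete between them. -/
def SimpleGraph.MixedPair {V : Type*} (G : SimpleGraph V) (P Q : Set V) : Prop :=
  (¬ ∀ x ∈ P, ∀ y ∈ Q, G.Adj x y) ∧ (¬ ∀ x ∈ P, ∀ y ∈ Q, ¬ G.Adj x y)

/-- The red degree of the part `P` within the partition `parts`:
the number of other parts forming a red pair with `P`. -/
noncomputable def SimpleGraph.redDeg {V : Type*} (G : SimpleGraph V)
    (parts : Set (Set V)) (P : Set V) : ℕ :=
  {Q ∈ parts | Q ≠ P ∧ G.MixedPair P Q}.ncard

/-- `Q` is obtained from `P` by contracting (merging) two distinct parts. -/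
def TwwStep {V : Type*} (P Q : Set (Set V)) : Prop :=
  ∃ A ∈ P, ∃ B ∈ P, A ≠ B ∧ Q = insert (A ∪ B) (P \ {A, B})

/-- `G` admits a sequence of `d`-contractions: a contraction sequence leading from
the partition of the vertex set into singletons to the partition with the single
part `univ` (i.e. the one-vertex trigraph), in which every vertex of every
intermediate trigraph has red degree at most `d`. -/
def SimpleGraph.HasDSeq {V : Type*} (G : SimpleGraph V) (d : ℕ) : Prop :=
  ∃ (N : ℕ) (f : ℕ → Set (Set V)),
    f 0 = Set.range (fun v => ({v} : Set V)) ∧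
    (∀ i < N, TwwStep (f i) (f (i + 1))) ∧
    f N = {Set.univ} ∧
    ∀ i ≤ N, ∀ P ∈ f i, G.redDeg (f i) P ≤ d

/-- The twin-width of `G`: the least `d` such that `G` admits a `d`-sequence. -/
noncomputable def SimpleGraph.twinWidth {V : Type*} (G : SimpleGraph V) : ℕ :=
  sInf {d | G.HasDSeq d}

/-- One contraction between partitions into disjoint parts, landing in a partition all of whose
red degrees are at most `d`. -/
def SimpleGraph.DStep {V : Type*} (G : SimpleGraph V) (d : ℕ) (P Q : Set (Set V)) : Prop :=
  TwwStep P Q ∧ P.PairwiseDisjoint id ∧ ∀ A ∈ Q, G.redDeg Q A ≤ d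

theorem TwwStep.pairwiseDisjoint {V : Type*} {P Q : Set (Set V)} (h : TwwStep P Q)
    (hP : P.PairwiseDisjoint id) : Q.PairwiseDisjoint id := by
  obtain ⟨A, hA, B, hB, -, rfl⟩ := h
  refine (hP.subset Set.sdiff_subset).insert fun C hC _ => ?_
  have hCA : A ≠ C := fun h => hC.2 (by simp [h])
  have hCB : B ≠ C := fun h => hC.2 (by simp [h])
  exact Set.disjoint_union_left.2 ⟨hP hA hC.1 hCA, hP hB hC.1 hCB⟩

theorem TwwStep.sUnion_eq {V : Type*} {P Q : Set (Set V)} (h : TwwStep P Q) :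
    ⋃₀ Q = ⋃₀ P := by
  obtain ⟨A, hA, B, hB, -, rfl⟩ := h
  ext v
  simp only [Set.mem_sUnion, Set.mem_insert_iff, Set.mem_sdiff, Set.mem_singleton_iff, not_or]
  constructor
  · rintro ⟨C, rfl | hC, hv⟩
    · exact hv.elim (fun hv => ⟨A, hA, hv⟩) fun hv => ⟨B, hB, hv⟩
    · exact ⟨C, hC.1, hv⟩
  · rintro ⟨C, hC, hv⟩
    by_cases h₁ : C = A
    · exact ⟨_, Or.inl rfl, Or.inl (h₁ ▸ hv)⟩
    by_cases h₂ : C = B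
    · exact ⟨_, Or.inl rfl, Or.inr (h₂ ▸ hv)⟩
    exact ⟨C, Or.inr ⟨hC, h₁, h₂⟩, hv⟩

theorem TwwStep.ncard_lt {V : Type*} [Finite V] {P Q : Set (Set V)} (h : TwwStep P Q) :
    Q.ncard < P.ncard := by
  obtain ⟨A, hA, B, hB, hAB, rfl⟩ := h
  have h₁ := Set.ncard_insert_le (A ∪ B) (P \ {A, B})
  have h₂ : ({A, B} : Set (Set V)) ⊆ P := Set.insert_subset hA (by simpa using hB)
  have h₃ := Set.ncard_sdiff_add_ncard_of_subset h₂
  rw [Set.ncard_pair hAB] at h₃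
  omega

theorem TwwStep.image {V W : Type*} {g : Set V → Set W} (hg : g.Injective)
    (hU : ∀ A B, g (A ∪ B) = g A ∪ g B) {R : Set (Set W)} (hR : ∀ A, g A ∉ R)
    {P Q : Set (Set V)} (h : TwwStep P Q) : TwwStep (g '' P ∪ R) (g '' Q ∪ R) := by
  obtain ⟨A, hA, B, hB, hAB, rfl⟩ := h
  refine ⟨g A, Or.inl ⟨A, hA, rfl⟩, g B, Or.inl ⟨B, hB, rfl⟩, hg.ne hAB, ?_⟩
  have hd : R \ {g A, g B} = R := by
    rw [sdiff_eq_left, Set.disjoint_right]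
    rintro C (rfl | rfl)
    exacts [hR A, hR B]
  rw [Set.image_insert_eq, hU, Set.image_sdiff hg, Set.image_pair, Set.union_sdiff_distrib, hd,
    Set.insert_union]

namespace SimpleGraph

variable {V : Type*} {G : SimpleGraph V} {d : ℕ}

theorem not_mixedPair_singleton (v w : V) : ¬ G.MixedPair {v} {w} := by
  simp [MixedPair]

theorem MixedPair.symm {P Q : Set V} (h : G.MixedPair P Q) : G.MixedPair Q P :=
  ⟨fun h' => h.1 fun a ha b hb => (h' b hb a ha).symm,
    fun h' => h.2 fun a ha b hb hab => h' b hb a ha hab.symm⟩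

theorem redDeg_eq_zero {parts : Set (Set V)} {P : Set V}
    (h : ∀ Q ∈ parts, Q ≠ P → ¬ G.MixedPair P Q) : G.redDeg parts P = 0 := by
  have : {Q ∈ parts | Q ≠ P ∧ G.MixedPair P Q} = ∅ :=
    Set.eq_empty_of_forall_notMem fun Q hQ => h Q hQ.1 hQ.2.1 hQ.2.2
  rw [redDeg, this, Set.ncard_empty]

theorem redDeg_le_of_image {W : Type*} [Finite V] {H : SimpleGraph W} (g : Set V → Set W)
    {P : Set (Set V)} {A : Set V} {P' : Set (Set W)} {A' : Set W}
    (h : ∀ B' ∈ P', B' ≠ A' → H.MixedPair A' B' →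
      ∃ B ∈ P, B ≠ A ∧ G.MixedPair A B ∧ g B = B') :
    H.redDeg P' A' ≤ G.redDeg P A := by
  have hs : {Q ∈ P' | Q ≠ A' ∧ H.MixedPair A' Q} ⊆
      g '' {Q ∈ P | Q ≠ A ∧ G.MixedPair A Q} := by
    rintro B' ⟨h₁, h₂, h₃⟩
    obtain ⟨B, hB, hne, hm, rfl⟩ := h B' h₁ h₂ h₃
    exact ⟨B, ⟨hB, hne, hm⟩, rfl⟩
  exact (Set.ncard_le_ncard hs (Set.toFinite _)).trans (Set.ncard_image_le (Set.toFinite _))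

theorem pairwiseDisjoint_range_singleton :
    (Set.range fun v : V => ({v} : Set V)).PairwiseDisjoint id := by
  rintro _ ⟨v, rfl⟩ _ ⟨w, rfl⟩ hne
  exact Set.disjoint_singleton.2 fun h => hne (by rw [h])

theorem hasDSeq_iff_reflTransGen : G.HasDSeq d ↔
    Relation.ReflTransGen (G.DStep d) (Set.range fun v => ({v} : Set V)) {Set.univ} := by
  constructor
  · rintro ⟨N, f, h0, hs, hN, hd⟩
    have key : ∀ i ≤ N, (f i).PairwiseDisjoint id ∧
        Relation.ReflTransGen (G.DStep d) (Set.range fun v => ({v} : Set V)) (f i) := by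
      intro i
      induction i with
      | zero => exact fun _ => by rw [h0]; exact ⟨pairwiseDisjoint_range_singleton, .refl⟩
      | succ i ih =>
        intro hi
        obtain ⟨h₁, h₂⟩ := ih (by omega)
        have h₃ := hs i (by omega)
        exact ⟨h₃.pairwiseDisjoint h₁, h₂.tail ⟨h₃, h₁, hd _ hi⟩⟩
    exact hN ▸ (key N le_rfl).2
  · unfold HasDSeq
    generalize ({Set.univ} : Set (Set V)) = R
    intro h
    induction h with
    | refl =>
      refine ⟨0, fun _ => _, rfl, by simp, rfl, ?_⟩
      rintro - - _ ⟨v, rfl⟩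
      rw [redDeg_eq_zero]
      · exact Nat.zero_le d
      · rintro _ ⟨w, rfl⟩ -
        exact not_mixedPair_singleton v w
    | @tail Q R _ hQR ih =>
      obtain ⟨N, f, h0, hs, hN, hd⟩ := ih
      refine ⟨N + 1, fun i => if i ≤ N then f i else R, by simpa using h0, ?_, by simp, ?_⟩
      · intro i hi
        rcases Nat.lt_succ_iff_lt_or_eq.1 hi with hi | rfl
        · simpa [hi.le, Nat.succ_le_of_lt hi] using hs i hi
        · simpa [hN] using hQR.1
      · intro i hi
        by_cases h : i ≤ N
        · simpa [h] using hd i h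
        · simpa [h] using hQR.2.2

theorem exists_hasDSeq [Finite V] [Nonempty V] (G : SimpleGraph V) : ∃ d, G.HasDSeq d := by
  refine ⟨Nat.card (Set V), hasDSeq_iff_reflTransGen.2 ?_⟩
  suffices ∀ (n : ℕ) (P : Set (Set V)), P.ncard = n → P.PairwiseDisjoint id → ⋃₀ P = Set.univ →
      Relation.ReflTransGen (G.DStep (Nat.card (Set V))) P {Set.univ} from
    this _ _ rfl pairwiseDisjoint_range_singleton (by ext; simp)
  intro n
  induction n using Nat.strong_induction_on with
  | _ n ih =>
    rintro P rfl hP hU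
    rcases P.subsingleton_or_nontrivial with h | ⟨A, hA, B, hB, hAB⟩
    · rcases h.eq_empty_or_singleton with rfl | ⟨A, rfl⟩
      · rw [Set.sUnion_empty] at hU
        exact (Set.empty_ne_univ hU).elim
      · rw [Set.sUnion_singleton] at hU
        rw [hU]
    · have hs : TwwStep P (insert (A ∪ B) (P \ {A, B})) := ⟨A, hA, B, hB, hAB, rfl⟩
      exact (ih _ hs.ncard_lt _ rfl (hs.pairwiseDisjoint hP) (hs.sUnion_eq.trans hU)).head
        ⟨hs, hP, fun C _ => Set.ncard_le_card _⟩

theorem HasDSeq.mono {e : ℕ} (h : G.HasDSeq d) (hde : d ≤ e) : G.HasDSeq e := by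
  obtain ⟨N, f, h0, hs, hN, hd⟩ := h
  exact ⟨N, f, h0, hs, hN, fun i hi P hP => (hd i hi P hP).trans hde⟩

theorem hasDSeq_twinWidth [Finite V] [Nonempty V] (G : SimpleGraph V) :
    G.HasDSeq G.twinWidth :=
  Nat.sInf_mem G.exists_hasDSeq

theorem HasDSeq.twinWidth_le (h : G.HasDSeq d) : G.twinWidth ≤ d :=
  Nat.sInf_le h

/-- The nonempty traces on `S` of the members of `P`. -/
def trace (S : Set V) (P : Set (Set V)) : Set (Set S) :=
  (fun A => Subtype.val ⁻¹' A) '' P \ {∅}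

theorem _root_.TwwStep.trace {S : Set V} {P Q : Set (Set V)} (h : TwwStep P Q)
    (hP : P.PairwiseDisjoint id) : trace S Q = trace S P ∨ TwwStep (trace S P) (trace S Q) := by
  obtain ⟨A, hA, B, hB, hAB, rfl⟩ := h
  let g : Set V → Set S := fun A => Subtype.val ⁻¹' A
  by_cases h0 : g A = ∅ ∨ g B = ∅
  · left
    ext C
    constructor
    · rintro ⟨⟨D, rfl | ⟨hD, -⟩, rfl⟩, hC⟩
      · rcases h0 with h | h
        · exact ⟨⟨B, hB, by change g B = g A ∪ g B; rw [h, Set.empty_union]⟩, hC⟩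
        · exact ⟨⟨A, hA, by change g A = g A ∪ g B; rw [h, Set.union_empty]⟩, hC⟩
      · exact ⟨⟨D, hD, rfl⟩, hC⟩
    · rintro ⟨⟨D, hD, rfl⟩, hC⟩
      by_cases hDA : D = A
      · subst hDA
        have h := h0.resolve_left hC
        exact ⟨⟨D ∪ B, Or.inl rfl, by change g D ∪ g B = g D; rw [h, Set.union_empty]⟩, hC⟩
      by_cases hDB : D = B
      · subst hDB
        have h := h0.resolve_right hC
        exact ⟨⟨A ∪ D, Or.inl rfl, by change g A ∪ g D = g D; rw [h, Set.empty_union]⟩, hC⟩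
      exact ⟨⟨D, Or.inr ⟨hD, by simp [hDA, hDB]⟩, rfl⟩, hC⟩
  right
  obtain ⟨hA0, hB0⟩ := not_or.1 h0
  have key : ∀ C ∈ P, ∀ D ∈ P, g C = g D → g C ≠ ∅ → C = D := by
    intro C hC D hD h hne
    obtain ⟨v, hv⟩ := Set.nonempty_iff_ne_empty.2 hne
    exact hP.elim_set hC hD v hv (show v ∈ g D from h ▸ hv)
  refine ⟨g A, ⟨⟨A, hA, rfl⟩, hA0⟩, g B, ⟨⟨B, hB, rfl⟩, hB0⟩,
    fun h => hAB (key A hA B hB h hA0), ?_⟩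
  ext C
  constructor
  · rintro ⟨⟨D, rfl | ⟨hD, hD'⟩, rfl⟩, hC⟩
    · exact Or.inl rfl
    · refine Or.inr ⟨⟨⟨D, hD, rfl⟩, hC⟩, ?_⟩
      rintro (h | h)
      · exact hD' (Or.inl (key D hD A hA h hC))
      · exact hD' (Or.inr (key D hD B hB h hC))
  · rintro (rfl | ⟨⟨⟨D, hD, rfl⟩, hC⟩, hC'⟩)
    · exact ⟨⟨A ∪ B, Or.inl rfl, rfl⟩, fun h => hA0 (Set.union_empty_iff.1 h).1⟩
    · refine ⟨⟨D, Or.inr ⟨hD, ?_⟩, rfl⟩, hC⟩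
      rintro (rfl | rfl)
      · exact hC' (Or.inl rfl)
      · exact hC' (Or.inr rfl)

theorem HasDSeq.induce [Finite V] (h : G.HasDSeq d) {S : Set V} (hS : S.Nonempty) :
    (G.induce S).HasDSeq d := by
  rw [hasDSeq_iff_reflTransGen] at h ⊢
  have h0 : trace S (Set.range fun v => ({v} : Set V)) = Set.range fun v => ({v} : Set S) := by
    ext C
    constructor
    · rintro ⟨⟨_, ⟨v, rfl⟩, rfl⟩, hC⟩
      obtain ⟨w, rfl⟩ := Set.nonempty_iff_ne_empty.2 hC
      exact ⟨w, by ext; simp [Subtype.ext_iff]⟩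
    · rintro ⟨v, rfl⟩
      exact ⟨⟨{v.1}, ⟨v, rfl⟩, by ext; simp [Subtype.ext_iff]⟩, Set.singleton_ne_empty v⟩
  have hN : trace S {Set.univ} = {Set.univ} := by
    have := hS.to_subtype
    simp [trace]
  rw [← h0, ← hN]
  refine Relation.ReflTransGen.lift' (trace S) (fun P Q hPQ => ?_) _ _ h
  obtain ⟨hs, hP, hd⟩ := hPQ
  rcases hs.trace (S := S) hP with he | ht
  · rw [Function.onFun, he]
  refine .single ⟨ht, ?_, ?_⟩
  · rintro _ ⟨⟨A, hA, rfl⟩, -⟩ _ ⟨⟨B, hB, rfl⟩, -⟩ hne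
    exact (hP hA hB fun h => hne (by rw [h])).preimage _
  · rintro _ ⟨⟨A, hA, rfl⟩, -⟩
    refine (redDeg_le_of_image (G := G) (P := Q) (A := A) (Subtype.val ⁻¹' ·) ?_).trans (hd A hA)
    rintro _ ⟨⟨B, hB, rfl⟩, -⟩ hne hm
    exact ⟨B, hB, fun h => hne (by rw [h]),
      ⟨fun h' => hm.1 fun a ha b hb => h' a ha b hb, fun h' => hm.2 fun a ha b hb => h' a ha b hb⟩,
      rfl⟩

theorem reflTransGen_extend_singletons [Finite V] {M : Set V}
    (hM : ∀ a ∈ M, ∀ b ∈ M, ∀ z ∉ M, (G.Adj a z ↔ G.Adj b z)) {P Q : Set (Set M)}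
    (h : Relation.ReflTransGen ((G.induce M).DStep d) P Q) :
    Relation.ReflTransGen (G.DStep d)
      ((Subtype.val '' ·) '' P ∪ (fun v => ({v} : Set V)) '' Mᶜ)
      ((Subtype.val '' ·) '' Q ∪ (fun v => ({v} : Set V)) '' Mᶜ) := by
  refine Relation.ReflTransGen.lift
    (fun P => (Subtype.val '' ·) '' P ∪ (fun v => ({v} : Set V)) '' Mᶜ) (fun P Q hPQ => ?_) _ _ h
  obtain ⟨hs, hP, hd⟩ := hPQ
  have hmix : ∀ (A : Set M), ∀ z ∉ M, ¬ G.MixedPair (Subtype.val '' A) {z} := by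
    rintro A z hz ⟨h₁, h₂⟩
    push Not at h₁ h₂
    obtain ⟨_, ⟨a, -, rfl⟩, _, rfl, ha⟩ := h₁
    obtain ⟨_, ⟨b, -, rfl⟩, _, rfl, hb⟩ := h₂
    exact ha ((hM a a.2 b b.2 _ hz).2 hb)
  refine ⟨hs.image Subtype.val_injective.image_injective (fun _ _ => Set.image_union _ _ _) ?_,
    ?_, ?_⟩
  · rintro A ⟨z, hz, h⟩
    have : z ∈ Subtype.val '' A := h ▸ rfl
    obtain ⟨a, -, rfl⟩ := this
    exact hz a.2
  · rintro _ (⟨A, hA, rfl⟩ | ⟨z, hz, rfl⟩) _ (⟨B, hB, rfl⟩ | ⟨w, hw, rfl⟩) hne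
    · exact (Set.disjoint_image_iff Subtype.val_injective).2 (hP hA hB fun h => hne (by rw [h]))
    · refine Set.disjoint_singleton_right.2 ?_
      rintro ⟨a, -, rfl⟩
      exact hw a.2
    · refine Set.disjoint_singleton_left.2 ?_
      rintro ⟨a, -, rfl⟩
      exact hz a.2
    · exact Set.disjoint_singleton.2 fun h => hne (by rw [h])
  · rintro _ (⟨A, hA, rfl⟩ | ⟨z, hz, rfl⟩)
    · refine (redDeg_le_of_image (G := G.induce M) (P := Q) (A := A) (Subtype.val '' ·) ?_).trans
        (hd A hA)
      rintro _ (⟨B, hB, rfl⟩ | ⟨w, hw, rfl⟩) hne hm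
      · refine ⟨B, hB, fun h => hne (by rw [h]),
          ⟨fun h' => hm.1 ?_, fun h' => hm.2 ?_⟩, rfl⟩
        · rintro _ ⟨a, ha, rfl⟩ _ ⟨b, hb, rfl⟩
          exact h' a ha b hb
        · rintro _ ⟨a, ha, rfl⟩ _ ⟨b, hb, rfl⟩
          exact h' a ha b hb
      · exact (hmix A w hw hm).elim
    · rw [redDeg_eq_zero]
      · exact Nat.zero_le d
      · rintro _ (⟨B, hB, rfl⟩ | ⟨w, hw, rfl⟩) -
        · exact fun h => hmix B z hz h.symm
        · exact not_mixedPair_singleton z w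

theorem reflTransGen_preimage [Finite V] {W : Type*} [Finite W] {H : SimpleGraph W} {φ : V → W}
    (hφ : φ.Surjective) (hadj : ∀ a b, φ a ≠ φ b → (G.Adj a b ↔ H.Adj (φ a) (φ b)))
    {P Q : Set (Set W)} (h : Relation.ReflTransGen (H.DStep d) P Q) :
    Relation.ReflTransGen (G.DStep d) ((φ ⁻¹' ·) '' P) ((φ ⁻¹' ·) '' Q) := by
  refine Relation.ReflTransGen.lift (fun P => (φ ⁻¹' ·) '' P)
    (fun P Q hPQ => ?_) _ _ h
  obtain ⟨hs, hP, hd⟩ := hPQ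
  refine ⟨?_, ?_, ?_⟩
  · simpa using hs.image (R := ∅) hφ.preimage_injective (fun _ _ => Set.preimage_union) (by simp)
  · rintro _ ⟨A, hA, rfl⟩ _ ⟨B, hB, rfl⟩ hne
    exact (hP hA hB fun h => hne (by rw [h])).preimage _
  · rintro _ ⟨A, hA, rfl⟩
    refine (redDeg_le_of_image (G := H) (P := Q) (A := A) (φ ⁻¹' ·) ?_).trans (hd A hA)
    rintro _ ⟨B, hB, rfl⟩ hne hm
    have hBA : B ≠ A := fun h => hne (by rw [h])
    have hdis : Disjoint A B := hs.pairwiseDisjoint hP hA hB hBA.symm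
    have hadj' : ∀ a ∈ φ ⁻¹' A, ∀ b ∈ φ ⁻¹' B, (G.Adj a b ↔ H.Adj (φ a) (φ b)) :=
      fun a ha b hb => hadj a b (hdis.ne_of_mem ha hb)
    exact ⟨B, hB, hBA,
      ⟨fun h' => hm.1 fun a ha b hb => (hadj' a ha b hb).2 (h' _ ha _ hb),
        fun h' => hm.2 fun a ha b hb => mt (hadj' a ha b hb).1 (h' _ ha _ hb)⟩, rfl⟩

theorem HasDSeq.of_module [Finite V] {M : Set V} {x : V} (hx : x ∈ M)
    (hM : ∀ a ∈ M, ∀ b ∈ M, ∀ z ∉ M, (G.Adj a z ↔ G.Adj b z))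
    (h₁ : (G.induce M).HasDSeq d) (h₂ : (G.induce (Mᶜ ∪ {x})).HasDSeq d) : G.HasDSeq d := by
  classical
  rw [hasDSeq_iff_reflTransGen] at h₁ h₂ ⊢
  have hxT : x ∈ Mᶜ ∪ {x} := Or.inr rfl
  have hMT : ∀ z ∉ M, z ∈ Mᶜ ∪ {x} := fun _ hz => Or.inl hz
  let φ : V → ↥(Mᶜ ∪ {x}) := fun v =>
    if hv : v ∈ M then ⟨x, hxT⟩ else ⟨v, hMT v hv⟩
  have hφM : ∀ v ∈ M, (φ v : V) = x := fun v hv => by simp [φ, hv]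
  have hφC : ∀ v ∉ M, (φ v : V) = v := fun v hv => by simp [φ, hv]
  have hφT : ∀ v (hv : v ∈ Mᶜ ∪ {x}), φ v = ⟨v, hv⟩ := by
    rintro v (hv | rfl)
    · exact Subtype.ext (hφC v hv)
    · exact Subtype.ext (hφM _ hx)
  have hφ : φ.Surjective := fun t => ⟨t, hφT t t.2⟩
  have hadj : ∀ a b, φ a ≠ φ b →
      (G.Adj a b ↔ (G.induce (Mᶜ ∪ {x})).Adj (φ a) (φ b)) := by
    intro a b hab
    rw [comap_adj, Function.Embedding.subtype_apply, Function.Embedding.subtype_apply]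
    by_cases ha : a ∈ M <;> by_cases hb : b ∈ M
    · exact (hab (Subtype.ext ((hφM a ha).trans (hφM b hb).symm))).elim
    · rw [hφM a ha, hφC b hb]
      exact hM a ha x hx b hb
    · rw [hφC a ha, hφM b hb, G.adj_comm, G.adj_comm a]
      exact hM b hb x hx a ha
    · rw [hφC a ha, hφC b hb]
  have e₁ := reflTransGen_extend_singletons hM h₁
  have e₂ := reflTransGen_preimage hφ hadj h₂
  have hstart : (Subtype.val '' ·) '' (Set.range fun v => ({v} : Set M)) ∪
      (fun v => ({v} : Set V)) '' Mᶜ = Set.range fun v => ({v} : Set V) := by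
    ext C
    constructor
    · rintro (⟨_, ⟨v, rfl⟩, rfl⟩ | ⟨v, -, rfl⟩)
      · exact ⟨v, by simp⟩
      · exact ⟨v, rfl⟩
    · rintro ⟨v, rfl⟩
      by_cases hv : v ∈ M
      · exact Or.inl ⟨_, ⟨⟨v, hv⟩, rfl⟩, by simp⟩
      · exact Or.inr ⟨v, hv, rfl⟩
  have hpre : ∀ z (hz : z ∉ M), φ ⁻¹' {⟨z, hMT z hz⟩} = {z} := by
    intro z hz
    ext v
    rw [Set.mem_preimage, Set.mem_singleton_iff, Set.mem_singleton_iff, Subtype.ext_iff]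
    by_cases hv : v ∈ M
    · rw [hφM v hv]
      exact ⟨fun h : x = z => (hz (h ▸ hx)).elim, fun h => (hz (h ▸ hv)).elim⟩
    · rw [hφC v hv]
  have hprex : φ ⁻¹' {⟨x, hxT⟩} = M := by
    ext v
    rw [Set.mem_preimage, Set.mem_singleton_iff, Subtype.ext_iff]
    by_cases hv : v ∈ M
    · simp [hφM v hv, hv]
    · rw [hφC v hv]
      exact ⟨fun h => h ▸ hx, fun h => (hv h).elim⟩
  have hmid : (Subtype.val '' ·) '' ({Set.univ} : Set (Set M)) ∪
      (fun v => ({v} : Set V)) '' Mᶜ =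
      (φ ⁻¹' ·) '' (Set.range fun v => ({v} : Set ↥(Mᶜ ∪ {x}))) := by
    ext C
    constructor
    · rintro (⟨_, rfl, rfl⟩ | ⟨v, hv, rfl⟩)
      · exact ⟨_, ⟨⟨x, Or.inr rfl⟩, rfl⟩, by simpa using hprex⟩
      · exact ⟨_, ⟨⟨v, Or.inl hv⟩, rfl⟩, hpre v hv⟩
    · rintro ⟨_, ⟨⟨v, hv | rfl⟩, rfl⟩, rfl⟩
      · exact Or.inr ⟨v, hv, (hpre v hv).symm⟩
      · exact Or.inl ⟨_, rfl, by simpa using hprex.symm⟩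
  rw [hstart] at e₁
  rw [← hmid, Set.image_singleton (a := Set.univ) (f := (φ ⁻¹' ·)), Set.preimage_univ] at e₂
  exact e₁.trans e₂

end SimpleGraph

/-- If `M` is a module of a finite graph `G` and `x ∈ M`, then
`tww(G) = max (tww(G[M])) (tww(G[(V(G) \ M) ∪ {x}]))`. -/
theorem twinWidth_module {V : Type*} [Fintype V] (G : SimpleGraph V) (M : Set V) (x : V)
    (hx : x ∈ M)
    (hM : ∀ a ∈ M, ∀ b ∈ M, ∀ z ∉ M, (G.Adj a z ↔ G.Adj b z)) :
    G.twinWidth = max (G.induce M).twinWidth (G.induce (Mᶜ ∪ {x})).twinWidth := by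
  have : Nonempty V := ⟨x⟩
  have : Nonempty M := ⟨⟨x, hx⟩⟩
  have : Nonempty ↥(Mᶜ ∪ {x}) := ⟨⟨x, Or.inr rfl⟩⟩
  apply le_antisymm
  · exact (SimpleGraph.HasDSeq.of_module hx hM
      ((SimpleGraph.hasDSeq_twinWidth _).mono (le_max_left _ _))
      ((SimpleGraph.hasDSeq_twinWidth _).mono (le_max_right _ _))).twinWidth_le
  · exact max_le (G.hasDSeq_twinWidth.induce ⟨x, hx⟩).twinWidth_le
      (G.hasDSeq_twinWidth.induce ⟨x, Or.inr rfl⟩).twinWidth_le
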